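/- arXiv:math/0209035 — 3 statements merged into one kernel-verified Lean document; each statement's English description precedes it below -/
import Mathlib

section
/- Let Λ be a category, let B, A : Λ ⥤ Type be functors, and let χ, ζ : B ⟶ A be two weakly cartesian natural transformations. Let p : A ⟶ C be the coequalizer of χ and ζ in the functor category Λ ⥤ Type (so that for each object X of Λ, C(X) is the quotient of A(X) by the equivalence relation generated by χ_X(b) ∼ ζ_X(b) for b ∈ B(X), and p_X the quotient map). Then p is weakly cartesian. -/
open CategoryTheory Limits

universe w u v

/-- A natural transformation `φ : F ⟶ G` between `Type v`-valued functors is weakly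
cartesian if every naturality square is a weak pullback: for every `h : X ⟶ Y`,
`a ∈ F(Y)` and `b ∈ G(X)` with `φ_Y(a) = G(h)(b)` there exists `w ∈ F(X)` with
`F(h)(w) = a` and `φ_X(w) = b`. -/
def WeaklyCartesian {Λ : Type u} [Category.{w} Λ] {F G : Λ ⥤ Type v} (φ : F ⟶ G) : Prop :=
  ∀ {X Y : Λ} (h : X ⟶ Y) (a : F.obj Y) (b : G.obj X),
    φ.app Y a = G.map h b → ∃ w : F.obj X, F.map h w = a ∧ φ.app X w = b

namespace CategoryTheory.Limits.Types

/-- A colimit cofork in types identifies only points related by the equivalence relation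
generated by `f x ∼ g x`. -/
theorem eqvGen_of_isColimit_cofork {X Y Z : Type v} {f g : X ⟶ Y} {π : Y ⟶ Z}
    {w : f ≫ π = g ≫ π} (h : IsColimit (Cofork.ofπ π w)) {a b : Y} (hab : π a = π b) :
    Relation.EqvGen (fun y y' => ∃ x, f x = y ∧ g x = y') a b := by
  let r : Y → Y → Prop := fun y y' => ∃ x, f x = y ∧ g x = y'
  let q : Y ⟶ Quot r := ↾(Quot.mk r)
  have hq : f ≫ q = g ≫ q := by
    ext x
    exact Quot.sound ⟨x, rfl, rfl⟩
  have hd : π ≫ Cofork.IsColimit.desc h q hq = q := Cofork.IsColimit.π_desc' h q hq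
  have key (y : Y) : Cofork.IsColimit.desc h q hq (π y) = q y := ConcreteCategory.congr_hom hd y
  refine Quot.eqvGen_exact (r := r) ?_
  change q a = q b
  rw [← key a, ← key b, hab]

theorem surjective_of_isColimit_cofork {X Y Z : Type v} {f g : X ⟶ Y} {π : Y ⟶ Z}
    {w : f ≫ π = g ≫ π} (h : IsColimit (Cofork.ofπ π w)) : Function.Surjective π :=
  (epi_iff_surjective π).1 (epi_of_isColimit_cofork h)

end CategoryTheory.Limits.Types

/-- Points related by the equivalence relation generated by two weakly cartesian transformations
lift simultaneously along `A.map h`. -/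
theorem WeaklyCartesian.exists_eqvGen_lift {Λ : Type u} [Category.{w} Λ] {B A : Λ ⥤ Type v}
    {χ ζ : B ⟶ A} (hχ : WeaklyCartesian χ) (hζ : WeaklyCartesian ζ) {X Y : Λ} (h : X ⟶ Y)
    {a a' : A.obj Y}
    (haa' : Relation.EqvGen (fun y y' => ∃ b, χ.app Y b = y ∧ ζ.app Y b = y') a a') :
    (∀ x, A.map h x = a → ∃ x', A.map h x' = a' ∧
      Relation.EqvGen (fun y y' => ∃ b, χ.app X b = y ∧ ζ.app X b = y') x x') ∧
    (∀ x', A.map h x' = a' → ∃ x, A.map h x = a ∧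
      Relation.EqvGen (fun y y' => ∃ b, χ.app X b = y ∧ ζ.app X b = y') x x') := by
  induction haa' with
  | rel a a' hr =>
    obtain ⟨b, rfl, rfl⟩ := hr
    constructor
    · intro x hx
      obtain ⟨c, rfl, rfl⟩ := hχ h b x hx.symm
      exact ⟨ζ.app X c, (NatTrans.naturality_apply ζ h c).symm, .rel _ _ ⟨c, rfl, rfl⟩⟩
    · intro x hx
      obtain ⟨c, rfl, rfl⟩ := hζ h b x hx.symm
      exact ⟨χ.app X c, (NatTrans.naturality_apply χ h c).symm, .rel _ _ ⟨c, rfl, rfl⟩⟩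
  | refl a => exact ⟨fun x hx => ⟨x, hx, .refl x⟩, fun x hx => ⟨x, hx, .refl x⟩⟩
  | symm a a' _ ih =>
    exact ⟨fun x hx => (ih.2 x hx).imp fun _ hy => ⟨hy.1, hy.2.symm⟩,
      fun x hx => (ih.1 x hx).imp fun _ hy => ⟨hy.1, hy.2.symm⟩⟩
  | trans a a' a'' _ _ ih₁ ih₂ =>
    constructor
    · intro x hx
      obtain ⟨y, hy, hxy⟩ := ih₁.1 x hx
      obtain ⟨z, hz, hyz⟩ := ih₂.1 y hy
      exact ⟨z, hz, hxy.trans _ _ _ hyz⟩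
    · intro z hz
      obtain ⟨y, hy, hyz⟩ := ih₂.2 z hz
      obtain ⟨x, hx, hxy⟩ := ih₁.2 y hy
      exact ⟨x, hx, hxy.trans _ _ _ hyz⟩

/-- If `χ, ζ : B ⟶ A` are weakly cartesian natural transformations between
`Type`-valued functors and `p : A ⟶ C` is their coequalizer in the functor
category (which is computed pointwise, so `C(X)` is the quotient of `A(X)` by the
equivalence relation generated by `χ_X(b) ∼ ζ_X(b)`), then `p` is weakly cartesian. -/
theorem weaklyCartesian_of_coequalizer
    {Λ : Type u} [Category.{w} Λ] {B A C : Λ ⥤ Type v}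
    (χ ζ : B ⟶ A) (p : A ⟶ C) (hp : χ ≫ p = ζ ≫ p)
    (hcolim : IsColimit (Cofork.ofπ p hp))
    (hχ : WeaklyCartesian χ) (hζ : WeaklyCartesian ζ) :
    WeaklyCartesian p := by
  have hev (Z : Λ) := isColimitCoforkMapOfIsColimit ((evaluation Λ (Type v)).obj Z) hp hcolim
  intro X Y h a c hac
  obtain ⟨x, rfl⟩ := Types.surjective_of_isColimit_cofork (hev X) c
  have hx : p.app Y (A.map h x) = p.app Y a :=
    (NatTrans.naturality_apply p h x).trans hac.symm
  obtain ⟨x', hx', hxx'⟩ :=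
    (hχ.exists_eqvGen_lift hζ h (Types.eqvGen_of_isColimit_cofork (hev Y) hx)).1 x rfl
  refine ⟨x', hx', ?_⟩
  have hsound (y y' : A.obj X) (hy : ∃ b, χ.app X b = y ∧ ζ.app X b = y') :
      p.app X y = p.app X y' := by
    obtain ⟨b, rfl, rfl⟩ := hy
    exact ConcreteCategory.congr_hom (NatTrans.congr_app hp X) b
  exact (congrArg (Quot.lift (p.app X) hsound) (Quot.eqvGen_sound hxx')).symm
end

section
/- Sequential colimits in the category of types preserve weak pullbacks: let W, A, B, C : ℕ ⥤ Type be functors (sequential diagrams) and let p : W ⟶ A, q : W ⟶ B, f : A ⟶ C, g : B ⟶ C be natural transformations with f ∘ p = g ∘ q such that for every i ∈ ℕ the commutative square formed by p_i, q_i, f_i, g_i is a weak pullback. Then the induced commutative square on sequential colimits, with sides colim p : colim W → colim A, colim q : colim W → colim B, colim f : colim A → colim C, colim g : colim B → colim C, is a weak pullback. -/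
open CategoryTheory Limits

universe u

/-- A commutative square of maps of types `p : W → A`, `q : W → B`, `f : A → C`,
`g : B → C` (with `f ∘ p = g ∘ q`) is a weak pullback if for every `a ∈ A` and
`b ∈ B` with `f(a) = g(b)` there exists `w ∈ W` with `p(w) = a` and `q(w) = b`. -/
def IsWeakPullback {W A B C : Type u} (p : W → A) (q : W → B) (f : A → C) (g : B → C) : Prop :=
  ∀ a b, f a = g b → ∃ w, p w = a ∧ q w = b

/-- Sequential colimits in `Type` preserve weak pullbacks: given sequential diagrams
`W, A, B, C : ℕ ⥤ Type` and natural transformations `p, q, f, g` with `p ≫ f = q ≫ g`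
such that each pointwise square is a weak pullback, the induced square on sequential
colimits is a weak pullback. -/
theorem sequential_colimit_preserves_weak_pullbacks
    (W A B C : ℕ ⥤ Type u) (p : W ⟶ A) (q : W ⟶ B) (f : A ⟶ C) (g : B ⟶ C)
    (hcomm : p ≫ f = q ≫ g)
    (h : ∀ i : ℕ, IsWeakPullback (p.app i) (q.app i) (f.app i) (g.app i)) :
    IsWeakPullback (colimMap p) (colimMap q) (colimMap f) (colimMap g) := by
  have map_ι : ∀ {F G : ℕ ⥤ Type u} (α : F ⟶ G) (i : ℕ) (x : F.obj i),
      colimMap α (colimit.ι F i x) = colimit.ι G i (α.app i x) := fun α i x =>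
    ConcreteCategory.congr_hom (ι_colimMap α i) x
  intro a b hab
  obtain ⟨i, x, rfl⟩ := Types.jointly_surjective' a
  obtain ⟨j, y, rfl⟩ := Types.jointly_surjective' b
  rw [map_ι, map_ι] at hab
  obtain ⟨k, s, t, hst⟩ := (Types.FilteredColimit.colimit_eq_iff C).1 hab
  have hfg : f.app k (A.map s x) = g.app k (B.map t y) := by
    rw [NatTrans.naturality_apply, NatTrans.naturality_apply]
    exact hst
  obtain ⟨w, hwx, hwy⟩ := h k _ _ hfg
  refine ⟨colimit.ι W k w, ?_, ?_⟩
  · rw [map_ι, hwx]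
    exact ConcreteCategory.congr_hom (colimit.w A s) x
  · rw [map_ι, hwy]
    exact ConcreteCategory.congr_hom (colimit.w B t) y
end

section
/- Consider two coequalizer diagrams in the category of types: parallel pairs u₂, v₂ : B₂ → A₂ with coequalizer p₂ : A₂ → C₂, and u₁, v₁ : B₁ → A₁ with coequalizer p₁ : A₁ → C₁, together with maps ψ : B₂ → B₁ and ζ : A₂ → A₁ satisfying ζ ∘ u₂ = u₁ ∘ ψ and ζ ∘ v₂ = v₁ ∘ ψ. Suppose that both commutative squares (the one with horizontal sides u₂, u₁ and vertical sides ψ, ζ, and the one with horizontal sides v₂, v₁ and vertical sides ψ, ζ) are weak pullbacks, and that ψ and ζ are injective. Then the induced map φ : C₂ → C₁ on coequalizers (characterized by φ ∘ p₂ = p₁ ∘ ζ) is injective. -/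
universe u

/-- The relation on `A` whose generated equivalence relation presents the coequalizer
of `u, v : B → A` in `Type` as the quotient `Quot (coeqRel u v)`. -/
def coeqRel {B A : Type u} (u v : B → A) : A → A → Prop :=
  fun a a' => ∃ b, u b = a ∧ v b = a'

/-- If both squares are weak pullbacks, the image of `ζ` is closed under the
equivalence relation generated by `coeqRel u₁ v₁`, and that equivalence lifts along `ζ`. -/
theorem exists_lift_of_eqvGen_coeqRel
    {B₂ A₂ B₁ A₁ : Type u}
    {u₂ v₂ : B₂ → A₂} {u₁ v₁ : B₁ → A₁} {ψ : B₂ → B₁} {ζ : A₂ → A₁}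
    (hu : ∀ b, ζ (u₂ b) = u₁ (ψ b)) (hv : ∀ b, ζ (v₂ b) = v₁ (ψ b))
    (hwu : IsWeakPullback u₂ ψ ζ u₁) (hwv : IsWeakPullback v₂ ψ ζ v₁)
    {x y : A₁} (h : Relation.EqvGen (coeqRel u₁ v₁) x y) :
    (∀ a, ζ a = x → ∃ a', ζ a' = y ∧ Quot.mk (coeqRel u₂ v₂) a = Quot.mk _ a') ∧
      (∀ a, ζ a = y → ∃ a', ζ a' = x ∧ Quot.mk (coeqRel u₂ v₂) a = Quot.mk _ a') := by
  induction h with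
  | rel x y hxy =>
    obtain ⟨b, rfl, rfl⟩ := hxy
    constructor
    · intro a ha
      obtain ⟨w, rfl, rfl⟩ := hwu a b ha
      exact ⟨v₂ w, hv w, Quot.sound ⟨w, rfl, rfl⟩⟩
    · intro a ha
      obtain ⟨w, rfl, rfl⟩ := hwv a b ha
      exact ⟨u₂ w, hu w, (Quot.sound ⟨w, rfl, rfl⟩).symm⟩
  | refl x => exact ⟨fun a ha => ⟨a, ha, rfl⟩, fun a ha => ⟨a, ha, rfl⟩⟩
  | symm x y _ ih => exact ih.symm
  | trans x y z _ _ ihxy ihyz =>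
    constructor
    · intro a ha
      obtain ⟨a', ha', h⟩ := ihxy.1 a ha
      obtain ⟨a'', ha'', h'⟩ := ihyz.1 a' ha'
      exact ⟨a'', ha'', h.trans h'⟩
    · intro a ha
      obtain ⟨a', ha', h⟩ := ihyz.2 a ha
      obtain ⟨a'', ha'', h'⟩ := ihxy.2 a' ha'
      exact ⟨a'', ha'', h.trans h'⟩

/-- Given a map of coequalizer diagrams in `Type` (maps `ψ : B₂ → B₁`, `ζ : A₂ → A₁`
commuting with the parallel pairs) such that both commuting squares are weak pullbacks
and `ψ`, `ζ` are injective, the induced map `φ` on coequalizers (characterized by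
`φ ∘ p₂ = p₁ ∘ ζ`) is injective. -/
theorem injective_of_coequalizer_map
    {B₂ A₂ B₁ A₁ : Type u}
    (u₂ v₂ : B₂ → A₂) (u₁ v₁ : B₁ → A₁) (ψ : B₂ → B₁) (ζ : A₂ → A₁)
    (hu : ∀ b, ζ (u₂ b) = u₁ (ψ b)) (hv : ∀ b, ζ (v₂ b) = v₁ (ψ b))
    (hwu : IsWeakPullback u₂ ψ ζ u₁)
    (hwv : IsWeakPullback v₂ ψ ζ v₁)
    (hψ : Function.Injective ψ) (hζ : Function.Injective ζ)
    (φ : Quot (coeqRel u₂ v₂) → Quot (coeqRel u₁ v₁))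
    (hφ : ∀ a : A₂, φ (Quot.mk _ a) = Quot.mk _ (ζ a)) :
    Function.Injective φ := by
  rintro ⟨a⟩ ⟨a'⟩ h
  have h₁ : Quot.mk (coeqRel u₁ v₁) (ζ a) = Quot.mk _ (ζ a') :=
    (hφ a).symm.trans (h.trans (hφ a'))
  obtain ⟨c, hc, hac⟩ :=
    (exists_lift_of_eqvGen_coeqRel hu hv hwu hwv (Quot.eqvGen_exact h₁)).1 a rfl
  exact hζ hc ▸ hac
end
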